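/- arXiv:1509.06947 — 4 statements merged into one kernel-verified Lean document; each statement's English description precedes it below -/
import Mathlib

section
/- Let a be a random vector in ℝ^n and let C ≥ 2 be a constant such that for every fixed x ∈ ℝ^n: E|a^T x|² = ‖x‖_2² and, for every q ≥ 1, ( E|a^T x|^q )^{1/q} ≤ C · q · ‖x‖_2 (i.e., the subexponential norm of a^T x is at most C‖x‖_2). Then for every x ∈ ℝ^n: ‖x‖_2 / ( 2·e³·C·(1 + log C) ) ≤ E|a^T x| ≤ ‖x‖_2. -/
open MeasureTheory Real

theorem upper_aux {Ω : Type*} [MeasurableSpace Ω] (μ : Measure Ω) [IsProbabilityMeasure μ]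
    (Y : Ω → ℝ) (s : ℝ) (hs : 0 ≤ s) (h1 : Integrable Y μ)
    (h2 : Integrable (fun ω => Y ω ^ 2) μ) (h : ∫ ω, Y ω ^ 2 ∂μ = s ^ 2) :
    ∫ ω, Y ω ∂μ ≤ s := by
  set M := ∫ ω, Y ω ∂μ with hM
  have : ∫ ω, (2 * M * Y ω - M ^ 2) ∂μ ≤ ∫ ω, Y ω ^ 2 ∂μ := by
    apply integral_mono ((h1.const_mul _).sub (integrable_const _)) h2
    intro ω
    change 2 * M * Y ω - M ^ 2 ≤ Y ω ^ 2
    nlinarith [sq_nonneg (Y ω - M)]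
  rw [integral_sub (h1.const_mul _) (integrable_const _), integral_const_mul, ← hM, h] at this
  simp at this
  apply le_of_sq_le_sq _ hs
  nlinarith

theorem const_aux (C : ℝ) (hC : 2 ≤ C) :
    (C * (2 * (1 + log C))) ^ ((1 + log C) / log C) ≤ 2 * exp 3 * C * (1 + log C) := by
  have hL : 0 < log C := log_pos (by linarith)
  have hC0 : 0 < C := by linarith
  set L := log C with hLd
  have hCe : C = exp L := (exp_log hC0).symm
  have hD : 0 < C * (2 * (1 + L)) := by positivity
  have e1 : (1 + L) / L = 1 + 1 / L := by field_simp; ring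
  rw [e1, rpow_add hD, rpow_one]
  have key : (C * (2 * (1 + L))) ^ (1 / L) ≤ exp 3 := by
    have hb : C * (2 * (1 + L)) ≤ exp (3 * L) := by
      have h3 : exp (3 * L) = C * (C * C) := by
        rw [hCe, ← exp_add, ← exp_add]; ring_nf
      rw [h3]
      have : 1 + L ≤ C := by rw [hCe]; linarith [add_one_le_exp L]
      gcongr
    calc _ ≤ (exp (3 * L)) ^ (1 / L) := rpow_le_rpow hD.le hb (by positivity)
      _ = exp 3 := by rw [← exp_mul]; congr 1; field_simp
  calc _ ≤ C * (2 * (1 + L)) * exp 3 := by gcongr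
    _ = _ := by ring

theorem lower_aux {Ω : Type*} [MeasurableSpace Ω] (μ : Measure Ω) [IsProbabilityMeasure μ]
    (Y : Ω → ℝ) (hY : ∀ ω, 0 ≤ Y ω) (s L D : ℝ) (hs : 0 < s) (hL : 0 < L) (hD : 0 < D)
    (h1 : Integrable Y μ)
    (h : ∫ ω, Y ω ^ 2 ∂μ = s ^ 2)
    (hq : Integrable (fun ω => Y ω ^ (2 * (1 + L))) μ)
    (hqm : (∫ ω, Y ω ^ (2 * (1 + L)) ∂μ) ^ (1 / (2 * (1 + L))) ≤ D * s) :
    s ≤ (∫ ω, Y ω ∂μ) * D ^ ((1 + L) / L) := by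
  set M := ∫ ω, Y ω ∂μ with hM
  have hM0 : 0 ≤ M := integral_nonneg hY
  set A := ∫ ω, Y ω ^ (2 * (1 + L)) ∂μ with hA
  have hA0 : 0 ≤ A := integral_nonneg fun ω => rpow_nonneg (hY ω) _
  have hpos : 0 < 1 + 2 * L := by linarith
  obtain ⟨α, hα⟩ : ∃ α, α = 2 * L / (1 + 2 * L) := ⟨_, rfl⟩
  have hα0 : 0 < α := by rw [hα]; positivity
  have hα1 : 1 - α = 1 / (1 + 2 * L) := by rw [hα]; field_simp; ring
  have hα2 : 2 - α = 2 * (1 + L) * (1 - α) := by rw [hα]; field_simp; ring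
  have hα3 : 2 - α = (1 + L) / L * α := by rw [hα]; field_simp; ring
  have hβ : 0 < 1 - α := by rw [hα1]; positivity
  have hconj : (1 / α).HolderConjugate (1 / (1 - α)) := by
    rw [Real.holderConjugate_iff]
    refine ⟨?_, by simp⟩
    rw [lt_div_iff₀ hα0]; linarith
  have eF : ∀ ω, (Y ω ^ α) ^ (1 / α) = Y ω := fun ω => by
    rw [← rpow_mul (hY ω), mul_one_div_cancel hα0.ne', rpow_one]
  have eG : ∀ ω, (Y ω ^ (2 - α)) ^ (1 / (1 - α)) = Y ω ^ (2 * (1 + L)) := fun ω => by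
    rw [← rpow_mul (hY ω), hα2]; congr 1; field_simp
  have hF : MemLp (fun ω => Y ω ^ α) (ENNReal.ofReal (1 / α)) μ := by
    rw [← integrable_norm_rpow_iff (h1.1.aemeasurable.pow_const _).aestronglyMeasurable
      (by simpa using hα0) ENNReal.ofReal_ne_top, ENNReal.toReal_ofReal (by positivity)]
    refine h1.congr (Filter.Eventually.of_forall fun ω => ?_)
    simp only
    rw [norm_of_nonneg (rpow_nonneg (hY ω) _), eF]
  have hG : MemLp (fun ω => Y ω ^ (2 - α)) (ENNReal.ofReal (1 / (1 - α))) μ := by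
    rw [← integrable_norm_rpow_iff (h1.1.aemeasurable.pow_const _).aestronglyMeasurable
      (by simpa using hβ) ENNReal.ofReal_ne_top, ENNReal.toReal_ofReal (by positivity)]
    refine hq.congr (Filter.Eventually.of_forall fun ω => ?_)
    simp only
    rw [norm_of_nonneg (rpow_nonneg (hY ω) _), eG]
  have H := integral_mul_le_Lp_mul_Lq_of_nonneg (μ := μ) hconj
    (Filter.Eventually.of_forall fun ω => rpow_nonneg (hY ω) α)
    (Filter.Eventually.of_forall fun ω => rpow_nonneg (hY ω) (2 - α)) hF hG
  have eP : ∀ ω, Y ω ^ α * Y ω ^ (2 - α) = Y ω ^ 2 := fun ω => by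
    rw [← rpow_add_of_nonneg (hY ω) hα0.le (by linarith), ← rpow_natCast]; congr 1; norm_num
  simp only [eP, eF, eG, h, one_div_one_div, ← hM, ← hA] at H
  have hAb : A ^ (1 - α) ≤ (D * s) ^ (2 - α) := by
    have : A ^ (1 - α) = (A ^ (1 / (2 * (1 + L)))) ^ (2 - α) := by
      rw [← rpow_mul hA0, hα2]; congr 1; field_simp
    rw [this]
    exact rpow_le_rpow (rpow_nonneg hA0 _) hqm (by linarith)
  have H2 : s ^ 2 ≤ M ^ α * (D * s) ^ (2 - α) :=
    H.trans (mul_le_mul_of_nonneg_left hAb (rpow_nonneg hM0 _))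
  have es : s ^ 2 = s ^ α * s ^ (2 - α) := by
    rw [← rpow_add hs, ← rpow_natCast]; congr 1; norm_num
  rw [es, mul_rpow hD.le hs.le, ← mul_assoc] at H2
  have H3 := le_of_mul_le_mul_right H2 (rpow_pos_of_pos hs _)
  rw [hα3, rpow_mul hD.le, ← mul_rpow hM0 (rpow_nonneg hD.le _)] at H3
  exact (rpow_le_rpow_iff hs.le (by positivity) hα0).1 H3

/-- If `a` is a random vector in `ℝ^n` with `E|aᵀx|² = ‖x‖₂²` for every `x` and with
subexponential norm of `aᵀx` bounded by `C‖x‖₂` (`C ≥ 2`), then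
`‖x‖₂ / (2 e³ C (1 + log C)) ≤ E|aᵀx| ≤ ‖x‖₂` for every `x`. -/
theorem stmt12 {Ω : Type*} [MeasurableSpace Ω] (μ : Measure Ω) [IsProbabilityMeasure μ]
    {n : ℕ} (a : Ω → Fin n → ℝ) (C : ℝ) (hC : 2 ≤ C)
    (hsq_int : ∀ x : Fin n → ℝ, Integrable (fun ω => (∑ j, a ω j * x j) ^ 2) μ)
    (hsq : ∀ x : Fin n → ℝ,
      (∫ ω, (∑ j, a ω j * x j) ^ 2 ∂μ) = ∑ j, x j ^ 2)
    (hmom_int : ∀ x : Fin n → ℝ, ∀ q : ℝ, 1 ≤ q →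
      Integrable (fun ω => |∑ j, a ω j * x j| ^ q) μ)
    (hmom : ∀ x : Fin n → ℝ, ∀ q : ℝ, 1 ≤ q →
      (∫ ω, |∑ j, a ω j * x j| ^ q ∂μ) ^ (1 / q) ≤
        C * q * Real.sqrt (∑ j, x j ^ 2)) :
    ∀ x : Fin n → ℝ,
      Real.sqrt (∑ j, x j ^ 2) / (2 * Real.exp 3 * C * (1 + Real.log C)) ≤
        ∫ ω, |∑ j, a ω j * x j| ∂μ ∧
      (∫ ω, |∑ j, a ω j * x j| ∂μ) ≤ Real.sqrt (∑ j, x j ^ 2) := by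
  intro x
  have hs0 : 0 ≤ ∑ j, x j ^ 2 := Finset.sum_nonneg fun j _ => sq_nonneg _
  have h1 : Integrable (fun ω => |∑ j, a ω j * x j|) μ := by
    simpa using hmom_int x 1 le_rfl
  have h2 : Integrable (fun ω => |∑ j, a ω j * x j| ^ 2) μ := by
    simpa only [sq_abs] using hsq_int x
  have h : ∫ ω, |∑ j, a ω j * x j| ^ 2 ∂μ = (Real.sqrt (∑ j, x j ^ 2)) ^ 2 := by
    rw [sq_sqrt hs0, ← hsq x]; simp only [sq_abs]
  refine ⟨?_, upper_aux μ _ _ (sqrt_nonneg _) h1 h2 h⟩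
  have hL : 0 < log C := log_pos (by linarith)
  have hC0 : 0 < C := by linarith
  have hM0 : 0 ≤ ∫ ω, |∑ j, a ω j * x j| ∂μ := integral_nonneg fun ω => abs_nonneg _
  rw [div_le_iff₀ (by positivity)]
  rcases (sqrt_nonneg (∑ j, x j ^ 2)).eq_or_lt with h0 | hs
  · rw [← h0]; positivity
  · have := lower_aux μ (fun ω => |∑ j, a ω j * x j|) (fun ω => abs_nonneg _)
      (Real.sqrt (∑ j, x j ^ 2)) (log C) (C * (2 * (1 + log C))) hs hL (by positivity) h1 h
      (hmom_int x _ (by linarith)) (hmom x _ (by linarith))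
    exact this.trans (mul_le_mul_of_nonneg_left (const_aux C hC) hM0)
end

section
/- Let H = ℓ²(ℕ, ℝ) with standard orthonormal basis (e_i)_{i∈ℕ}, let r ∈ (0,1) and β > 0, and define x_i := r^i · (e_i + β·e_0) for integers i ≥ 1. Then for all integers j > i ≥ 1: |⟨x_i − x_j, e_0⟩| ≤ ‖x_i − x_j‖ and |⟨x_i − x_j, e_0⟩|² ≥ α² · ‖x_i − x_j‖², where α² := β²(1−r)² / (1 + r² + β²). Equivalently, the linear map L(x) := ⟨x, e_0⟩ satisfies α ≤ |L(y)| ≤ 1 for every normalised secant y = (x_i − x_j)/‖x_i − x_j‖ with i ≠ j, so L stably embeds Σ := {x_i : i ≥ 1} into ℝ. -/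
open scoped RealInnerProductSpace

/-- In `ℓ²(ℕ,ℝ)`, with `x_i = r^i (e_i + β e_0)` for `i ≥ 1` (`r ∈ (0,1)`, `β > 0`): for all
`j > i ≥ 1`, `|⟪x_i − x_j, e_0⟫| ≤ ‖x_i − x_j‖` and `⟪x_i − x_j, e_0⟫² ≥ α² ‖x_i − x_j‖²`
where `α² = β²(1−r)²/(1+r²+β²)`; equivalently, `L(x) = ⟪x, e_0⟫` satisfies
`α ≤ |L(y)| ≤ 1` for every normalised secant `y` of `Σ = {x_i : i ≥ 1}`. -/
theorem stmt15 (r β : ℝ) (hr0 : 0 < r) (hr1 : r < 1) (hβ : 0 < β)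
    (e : ℕ → lp (fun _ : ℕ => ℝ) 2) (he : ∀ i, e i = lp.single 2 i (1 : ℝ))
    (x : ℕ → lp (fun _ : ℕ => ℝ) 2)
    (hx : ∀ i : ℕ, x i = r ^ i • (e i + β • e 0))
    (α : ℝ) (hα0 : 0 ≤ α) (hα : α ^ 2 = β ^ 2 * (1 - r) ^ 2 / (1 + r ^ 2 + β ^ 2)) :
    (∀ i j : ℕ, 1 ≤ i → i < j →
      |⟪x i - x j, e 0⟫| ≤ ‖x i - x j‖ ∧
      α ^ 2 * ‖x i - x j‖ ^ 2 ≤ ⟪x i - x j, e 0⟫ ^ 2) ∧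
    (∀ i j : ℕ, 1 ≤ i → 1 ≤ j → i ≠ j →
      α ≤ |⟪‖x i - x j‖⁻¹ • (x i - x j), e 0⟫| ∧
      |⟪‖x i - x j‖⁻¹ • (x i - x j), e 0⟫| ≤ 1) := by
  have hin : ∀ i j : ℕ, ⟪e i, e j⟫ = if i = j then (1 : ℝ) else 0 := by
    intro i j
    rw [he i, he j, lp.inner_single_left]
    by_cases h : i = j
    · subst h
      simp
    · simp [lp.single_apply, h]
  have hL : ∀ i j : ℕ, 1 ≤ i → 1 ≤ j → ⟪x i - x j, e 0⟫ = β * (r ^ i - r ^ j) := by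
    intro i j hi hj
    have h1 : i ≠ 0 := by omega
    have h2 : j ≠ 0 := by omega
    rw [hx i, hx j]
    simp only [inner_sub_left, inner_add_left, real_inner_smul_left, hin, h1, h2, if_true, if_false]
    ring
  have hN : ∀ i j : ℕ, 1 ≤ i → 1 ≤ j → i ≠ j →
      ‖x i - x j‖ ^ 2 = (r ^ i) ^ 2 + (r ^ j) ^ 2 + β ^ 2 * (r ^ i - r ^ j) ^ 2 := by
    intro i j hi hj hij
    have h1 : i ≠ 0 := by omega
    have h2 : j ≠ 0 := by omega
    rw [← real_inner_self_eq_norm_sq, hx i, hx j]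
    simp only [inner_sub_left, inner_add_left, real_inner_smul_left, inner_sub_right,
      inner_add_right, real_inner_smul_right, hin, h1, h2, hij, hij.symm, h1.symm, h2.symm,
      if_true, if_false]
    ring
  have hup : ∀ i j : ℕ, |⟪x i - x j, e 0⟫| ≤ ‖x i - x j‖ := by
    intro i j
    have h0 : ‖e 0‖ = 1 := by
      have h := real_inner_self_eq_norm_sq (e 0)
      rw [hin, if_pos rfl] at h
      nlinarith [norm_nonneg (e 0)]
    have h := abs_real_inner_le_norm (x i - x j) (e 0)
    rwa [h0, mul_one] at h
  have hlow : ∀ i j : ℕ, 1 ≤ i → i < j →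
      α ^ 2 * ‖x i - x j‖ ^ 2 ≤ ⟪x i - x j, e 0⟫ ^ 2 := by
    intro i j hi hij
    rw [hL i j hi (by omega), hN i j hi (by omega) hij.ne, hα]
    have ha : 0 < r ^ i := by positivity
    have hb : 0 < r ^ j := by positivity
    have hba : r ^ j ≤ r * r ^ i := by
      rw [← pow_succ']
      exact pow_le_pow_of_le_one hr0.le hr1.le hij
    generalize r ^ i = a at *
    generalize r ^ j = b at *
    have hD : 0 < 1 + r ^ 2 + β ^ 2 := by positivity
    rw [div_mul_eq_mul_div, div_le_iff₀ hD]
    have h1 : (1 - r) * a ≤ a - b := by linarith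
    have h2 : ((1 - r) * a) ^ 2 ≤ (a - b) ^ 2 :=
      pow_le_pow_left₀ (mul_nonneg (by linarith) ha.le) h1 2
    have h3 : b ^ 2 ≤ (r * a) ^ 2 := pow_le_pow_left₀ hb.le hba 2
    have h4 : (1 - r) ^ 2 ≤ 1 := by nlinarith
    have h5 : (1 - r) ^ 2 * (a ^ 2 + b ^ 2) ≤ (1 + r ^ 2) * (a - b) ^ 2 := by
      calc (1 - r) ^ 2 * (a ^ 2 + b ^ 2) ≤ (1 - r) ^ 2 * (a ^ 2 + (r * a) ^ 2) := by gcongr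
        _ = (1 + r ^ 2) * ((1 - r) * a) ^ 2 := by ring
        _ ≤ _ := by gcongr
    have h6 : (1 - r) ^ 2 * (β ^ 2 * (a - b) ^ 2) ≤ 1 * (β ^ 2 * (a - b) ^ 2) := by gcongr
    have h7 := mul_le_mul_of_nonneg_left (add_le_add h5 h6) (sq_nonneg β)
    linarith
  refine ⟨fun i j hi hij => ⟨hup i j, hlow i j hi hij⟩, fun i j hi hj hij => ?_⟩
  have hpos : 0 < ‖x i - x j‖ := by
    have h := hN i j hi hj hij
    have h' : 0 < ‖x i - x j‖ ^ 2 := by rw [h]; positivity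
    exact lt_of_le_of_ne (norm_nonneg _) (fun h0 => by simp [← h0] at h')
  have hlow' : α ^ 2 * ‖x i - x j‖ ^ 2 ≤ ⟪x i - x j, e 0⟫ ^ 2 := by
    rcases lt_or_gt_of_ne hij with h | h
    · exact hlow i j hi h
    · have := hlow j i hj h
      rw [← neg_sub (x i) (x j), norm_neg, inner_neg_left, neg_sq] at this
      exact this
  rw [real_inner_smul_left, abs_mul, abs_of_pos (inv_pos.2 hpos), ← div_eq_inv_mul]
  refine ⟨?_, (div_le_one hpos).2 (hup i j)⟩
  rw [le_div_iff₀ hpos]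
  refine (pow_le_pow_iff_left₀ (mul_nonneg hα0 hpos.le) (abs_nonneg _) two_ne_zero).1 ?_
  rw [mul_pow, sq_abs]
  exact hlow'
end

section
/- Let H = ℓ²(ℕ, ℝ) with standard orthonormal basis (e_i)_{i∈ℕ}, let r ∈ (0,1) and β > 0, define x_i := r^i · (e_i + β·e_0) for integers i ≥ 1, and for each integer k ≥ 1 define the normalised secant v_k := (x_{2k} − x_{2k+1}) / ‖x_{2k} − x_{2k+1}‖. Then for all integers k ≠ k' with k, k' ≥ 1: ‖v_k − v_{k'}‖ ≥ 1 / √(1 + r² + β²(1−r)²). Consequently, for every ε < (1/2)·(1 + r² + β²(1−r)²)^{−1/2}, the normalised secant set of Σ := {x_i : i ≥ 1} admits no finite cover by balls of radius ε, and hence has infinite upper box-counting dimension. -/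
open scoped RealInnerProductSpace

/-- In `ℓ²(ℕ,ℝ)`, with `x_i = r^i (e_i + β e_0)` and normalised secants
`v_k = (x_{2k} − x_{2k+1})/‖x_{2k} − x_{2k+1}‖`: for all `k ≠ k'` (`k, k' ≥ 1`),
`‖v_k − v_{k'}‖ ≥ 1/√(1+r²+β²(1−r)²)`; consequently, for every
`ε < (1/2)(1+r²+β²(1−r)²)^{-1/2}`, the normalised secant set of `Σ = {x_i : i ≥ 1}` admits no
finite cover by balls of radius `ε`. -/
theorem stmt16 (r β : ℝ) (hr0 : 0 < r) (hr1 : r < 1) (hβ : 0 < β)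
    (e : ℕ → lp (fun _ : ℕ => ℝ) 2) (he : ∀ i, e i = lp.single 2 i (1 : ℝ))
    (x : ℕ → lp (fun _ : ℕ => ℝ) 2)
    (hx : ∀ i : ℕ, x i = r ^ i • (e i + β • e 0))
    (v : ℕ → lp (fun _ : ℕ => ℝ) 2)
    (hv : ∀ k : ℕ, v k = ‖x (2 * k) - x (2 * k + 1)‖⁻¹ • (x (2 * k) - x (2 * k + 1))) :
    (∀ k k' : ℕ, 1 ≤ k → 1 ≤ k' → k ≠ k' →
      1 / Real.sqrt (1 + r ^ 2 + β ^ 2 * (1 - r) ^ 2) ≤ ‖v k - v k'‖) ∧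
    (∀ ε : ℝ, ε < 1 / 2 * (1 + r ^ 2 + β ^ 2 * (1 - r) ^ 2) ^ (-(1 : ℝ) / 2) →
      ¬ ∃ F : Finset (lp (fun _ : ℕ => ℝ) 2),
        ∀ y ∈ {y : lp (fun _ : ℕ => ℝ) 2 |
            ∃ i j : ℕ, 1 ≤ i ∧ 1 ≤ j ∧ x i ≠ x j ∧ y = ‖x i - x j‖⁻¹ • (x i - x j)},
          ∃ c ∈ F, ‖y - c‖ ≤ ε) := by
  set D : ℝ := 1 + r ^ 2 + β ^ 2 * (1 - r) ^ 2 with hD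
  have hDpos : 0 < D := by positivity
  have hin : ∀ i j : ℕ, ⟪e i, e j⟫ = if i = j then (1 : ℝ) else 0 := by
    intro i j
    rw [he, he, lp.inner_single_left]
    by_cases h : i = j
    · subst h; simp
    · simp [h, Pi.single_apply]
  have hcoord : ∀ i j : ℕ, (e i : ℕ → ℝ) j = if j = i then (1 : ℝ) else 0 := by
    intro i j
    rw [he]
    by_cases h : j = i
    · subst h; simp
    · simp [h, Pi.single_apply]
  have hw : ∀ k : ℕ, x (2 * k) - x (2 * k + 1) =
      r ^ (2 * k) • (e (2 * k) - r • e (2 * k + 1) + (β * (1 - r)) • e 0) := by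
    intro k
    rw [hx, hx, pow_succ]
    module
  have hn : ∀ k : ℕ, 1 ≤ k →
      ‖e (2 * k) - r • e (2 * k + 1) + (β * (1 - r)) • e 0‖ = Real.sqrt D := by
    intro k hk
    have h1 : (2 * k = 0) = False := by simp; omega
    have h2 : (0 = 2 * k) = False := by simp; omega
    have h3 : (2 * k = 2 * k + 1) = False := by simp
    have h4 : (2 * k + 1 = 2 * k) = False := by simp
    have h5 : (2 * k + 1 = 0) = False := by simp
    have h6 : (0 = 2 * k + 1) = False := by simp
    rw [@norm_eq_sqrt_real_inner]
    congr 1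
    simp only [inner_add_left, inner_add_right, inner_sub_left, inner_sub_right,
      real_inner_smul_left, real_inner_smul_right, hin, h1, h2, h3, h4, h5, h6, if_true, if_false]
    rw [hD]; ring
  have hvk : ∀ k : ℕ, 1 ≤ k → v k =
      (Real.sqrt D)⁻¹ • (e (2 * k) - r • e (2 * k + 1) + (β * (1 - r)) • e 0) := by
    intro k hk
    have hp : 0 < r ^ (2 * k) := by positivity
    rw [hv, hw, norm_smul, hn k hk, smul_smul, Real.norm_of_nonneg hp.le]
    congr 1
    field_simp
  have hsep : ∀ k k' : ℕ, 1 ≤ k → 1 ≤ k' → k ≠ k' → 1 / Real.sqrt D ≤ ‖v k - v k'‖ := by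
    intro k k' hk hk' hne
    have h1 : (2 * k = 0) = False := by simp; omega
    have h2 : (2 * k = 2 * k + 1) = False := by simp
    have h3 : (2 * k = 2 * k') = False := by simp; omega
    have h4 : (2 * k = 2 * k' + 1) = False := by simp; omega
    have hle := lp.norm_apply_le_norm (p := 2) (by norm_num) (v k - v k') (2 * k)
    refine le_trans (le_of_eq ?_) hle
    rw [hvk k hk, hvk k' hk']
    simp only [lp.coeFn_sub, lp.coeFn_add, lp.coeFn_smul, Pi.sub_apply, Pi.add_apply,
      Pi.smul_apply, hcoord, h1, h2, h3, h4, if_true, if_false, smul_eq_mul]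
    have hs : 0 < (Real.sqrt D)⁻¹ := by positivity
    rw [Real.norm_of_nonneg]
    · simp
    · simpa using hs.le
  refine ⟨hsep, ?_⟩
  rintro ε hε ⟨F, hF⟩
  have hrp : D ^ (-(1 : ℝ) / 2) = 1 / Real.sqrt D := by
    rw [neg_div, Real.rpow_neg hDpos.le, Real.sqrt_eq_rpow, one_div (D ^ _)]
  rw [hrp] at hε
  have hmem : ∀ k : ℕ, ∃ c ∈ F, ‖v (k + 1) - c‖ ≤ ε := by
    intro k
    refine hF _ ⟨2 * (k + 1), 2 * (k + 1) + 1, by omega, by omega, ?_, hv _⟩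
    intro h
    have h0 : x (2 * (k + 1)) - x (2 * (k + 1) + 1) = 0 := sub_eq_zero.mpr h
    rw [hw] at h0
    have h1 := congrArg norm h0
    rw [norm_smul, hn _ (by omega), norm_zero] at h1
    have : 0 < ‖r ^ (2 * (k + 1))‖ * Real.sqrt D :=
      mul_pos (norm_pos_iff.mpr (pow_pos hr0 _).ne') (Real.sqrt_pos.mpr hDpos)
    linarith
  choose c hcF hc using hmem
  obtain ⟨a, b, hab, hcab⟩ := Finite.exists_ne_map_eq_of_infinite
    (fun k : ℕ => (⟨c k, hcF k⟩ : F))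
  have hcab' : c a = c b := congrArg Subtype.val hcab
  have h1 := hsep (a + 1) (b + 1) (by omega) (by omega) (by omega)
  have h2 : ‖v (a + 1) - v (b + 1)‖ ≤ ‖v (a + 1) - c a‖ + ‖v (b + 1) - c a‖ := by
    have := norm_sub_le (v (a + 1) - c a) (v (b + 1) - c a)
    rwa [sub_sub_sub_cancel_right] at this
  have h3 := hc a
  have h4 := hc b
  rw [← hcab'] at h4
  linarith
end

section
/- Let H = ℓ²(ℕ, ℝ) with standard orthonormal basis (e_i)_{i∈ℕ}, let r ∈ (0,1) and β > 0, and let Σ := { x_i : i ≥ 1 } where x_i := r^i · (e_i + β·e_0). Then the upper box-counting dimension of Σ is 0: for every s > 0 there exists ε₀ > 0 such that for every ε ∈ (0, ε₀] there is a finite set F ⊆ H with cardinality at most ε^{−s} such that every point of Σ lies within distance ε of some point of F. (Indeed, for any ε > 0, Σ is covered by at most i*(ε) closed balls of radius ε, where i*(ε) is the smallest positive integer with r^{i*(ε)}·√(1+β²) ≤ ε, since ‖x_i‖ = r^i·√(1+β²).) -/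
/-- In `ℓ²(ℕ,ℝ)`, the set `Σ = {x_i : i ≥ 1}` with `x_i = r^i (e_i + β e_0)` has upper
box-counting dimension `0`: for every `s > 0` there is `ε₀ > 0` such that for every
`ε ∈ (0, ε₀]` there is a finite set `F` of cardinality at most `ε^{-s}` such that every point
of `Σ` lies within distance `ε` of a point of `F`. -/
theorem stmt17 (r β : ℝ) (hr0 : 0 < r) (hr1 : r < 1) (hβ : 0 < β)
    (e : ℕ → lp (fun _ : ℕ => ℝ) 2) (he : ∀ i, e i = lp.single 2 i (1 : ℝ))
    (x : ℕ → lp (fun _ : ℕ => ℝ) 2)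
    (hx : ∀ i : ℕ, x i = r ^ i • (e i + β • e 0)) :
    ∀ s : ℝ, 0 < s → ∃ ε₀ : ℝ, 0 < ε₀ ∧
      ∀ ε : ℝ, 0 < ε → ε ≤ ε₀ →
        ∃ F : Finset (lp (fun _ : ℕ => ℝ) 2),
          (F.card : ℝ) ≤ ε ^ (-s) ∧
          ∀ i : ℕ, 1 ≤ i → ∃ c ∈ F, ‖x i - c‖ ≤ ε := by
  classical
  intro s hs
  have hL : 0 < -Real.log r := by
    have := Real.log_neg hr0 hr1
    linarith
  set L := -Real.log r with hLdef
  set C := 1 + β with hC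
  have hCpos : 0 < C := by positivity
  have hnorm : ∀ i, ‖x i‖ ≤ r ^ i * C := by
    intro i
    have he1 : ∀ j, ‖e j‖ = 1 := by
      intro j
      rw [he j, lp.norm_single (by norm_num)]
      simp
    rw [hx i, norm_smul, Real.norm_of_nonneg (pow_nonneg hr0.le i)]
    refine mul_le_mul_of_nonneg_left ?_ (pow_nonneg hr0.le i)
    refine (norm_add_le _ _).trans ?_
    rw [norm_smul, he1, he1, Real.norm_of_nonneg hβ.le, mul_one]
  have h1 : ∀ᶠ t : ℝ in Filter.atTop, Real.log t ≤ (L / 2) * t ^ s := by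
    have h := (isLittleO_log_rpow_atTop hs).bound (half_pos hL)
    filter_upwards [h, Filter.eventually_ge_atTop 1] with t ht ht1
    rw [Real.norm_of_nonneg (Real.rpow_nonneg (by linarith) s)] at ht
    exact (le_abs_self _).trans ht
  have h2 : ∀ᶠ t : ℝ in Filter.atTop, 2 * (Real.log C / L + 2) ≤ t ^ s :=
    (tendsto_rpow_atTop hs).eventually_ge_atTop _
  obtain ⟨T, hT⟩ := Filter.eventually_atTop.1 (h1.and h2)
  have hM : 0 < max (max T 1) (1 / C) := lt_max_of_lt_left (lt_max_of_lt_right one_pos)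
  refine ⟨(max (max T 1) (1 / C))⁻¹, inv_pos.2 hM, ?_⟩
  intro ε hε hε0
  have hεM : max (max T 1) (1 / C) ≤ ε⁻¹ := (le_inv_comm₀ hε hM).1 hε0
  have hTε : T ≤ ε⁻¹ := ((le_max_left _ _).trans (le_max_left _ _)).trans hεM
  have hCε : 1 / C ≤ ε⁻¹ := (le_max_right _ _).trans hεM
  obtain ⟨ha, hb⟩ := hT _ hTε
  rw [Real.inv_rpow hε.le, ← Real.rpow_neg hε.le] at ha hb
  have hlog : 0 ≤ Real.log ε⁻¹ + Real.log C := by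
    rw [← Real.log_mul (by positivity) hCpos.ne']
    apply Real.log_nonneg
    rwa [div_le_iff₀ hCpos] at hCε
  set N := ⌈(Real.log ε⁻¹ + Real.log C) / L⌉₊ with hN
  have hN1 : (N : ℝ) < (Real.log ε⁻¹ + Real.log C) / L + 1 :=
    Nat.ceil_lt_add_one (by positivity)
  have hN2 : (Real.log ε⁻¹ + Real.log C) / L ≤ N := Nat.le_ceil _
  have hrN : r ^ N * C ≤ ε := by
    rw [← Real.log_le_log_iff (by positivity) hε, Real.log_mul (by positivity) hCpos.ne',
      Real.log_pow]
    rw [div_le_iff₀ hL, Real.log_inv] at hN2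
    have : (N : ℝ) * L = -(N * Real.log r) := by rw [hLdef]; ring
    linarith
  refine ⟨insert 0 ((Finset.range N).image x), ?_, ?_⟩
  · have hc : (insert 0 ((Finset.range N).image x)).card ≤ N + 1 := by
      refine (Finset.card_insert_le _ _).trans ?_
      have := Finset.card_image_le (s := Finset.range N) (f := x)
      rw [Finset.card_range] at this
      omega
    have hc' : ((insert 0 ((Finset.range N).image x)).card : ℝ) ≤ N + 1 := by exact_mod_cast hc
    have h3 : Real.log ε⁻¹ / L ≤ ε ^ (-s) / 2 := by
      rw [div_le_iff₀ hL]
      linarith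
    rw [add_div] at hN1
    linarith
  · intro i _
    by_cases hi : i < N
    · exact ⟨x i, Finset.mem_insert_of_mem (Finset.mem_image_of_mem x (Finset.mem_range.2 hi)),
        by simpa using hε.le⟩
    · refine ⟨0, Finset.mem_insert_self _ _, ?_⟩
      rw [sub_zero]
      refine (hnorm i).trans (le_trans ?_ hrN)
      exact mul_le_mul_of_nonneg_right
        (pow_le_pow_of_le_one hr0.le hr1.le (not_lt.1 hi)) hCpos.le
end
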